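/- Let A be an invertible 2×2 real matrix and F : ℝ² → ℝ² a C¹ map with F(0) = 0 such that for all p, ‖DF_p − A‖ < δ. If for each k = 1, …, n the matrix A^k has no eigenvalue in [1, 1+ε), then for δ small enough, Spec(F^k) ∩ [1, 1+ε') = ∅ for some ε' > 0 and each k ≤ n, so F^k has at most one fixed point. -/

import Mathlib

open Filter Topology in
theorem aux_deriv (A : (ℝ × ℝ) →L[ℝ] (ℝ × ℝ)) (k : ℕ) : ∀ η > 0, ∃ δ > 0,
    ∀ F : ℝ × ℝ → ℝ × ℝ, Differentiable ℝ F → (∀ p : ℝ × ℝ, ‖fderiv ℝ F p - A‖ < δ) →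
      ∀ p, ‖fderiv ℝ (F^[k]) p - A ^ k‖ < η := by
  induction k with
  | zero =>
    intro η hη
    refine ⟨1, one_pos, fun F _ _ p => ?_⟩
    have : fderiv ℝ (F^[0]) p = 1 := by
      rw [Function.iterate_zero]; exact fderiv_id
    rw [this]; simpa using hη
  | succ k ih =>
    intro η hη
    have hc : Continuous fun x : ((ℝ × ℝ) →L[ℝ] (ℝ × ℝ)) × ((ℝ × ℝ) →L[ℝ] (ℝ × ℝ)) =>
      x.1 * x.2 := continuous_mul
    obtain ⟨d, hd, H⟩ := Metric.continuous_iff.1 hc (A ^ k, A) η hη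
    obtain ⟨δ, hδ, hF⟩ := ih d hd
    refine ⟨min δ d, lt_min hδ hd, fun F hdiff hA p => ?_⟩
    have h1 := hF F hdiff (fun p => (hA p).trans_le (min_le_left _ _)) (F p)
    have h2 := (hA p).trans_le (min_le_right _ _)
    have h3 : fderiv ℝ (F^[k + 1]) p = fderiv ℝ (F^[k]) (F p) * fderiv ℝ F p := by
      rw [Function.iterate_succ]
      exact fderiv_comp p (hdiff.iterate k _) (hdiff p)
    have := H (fderiv ℝ (F^[k]) (F p), fderiv ℝ F p) (by
      rw [Prod.dist_eq, dist_eq_norm, dist_eq_norm]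
      exact max_lt h1 h2)
    rw [dist_eq_norm] at this
    rwa [h3, pow_succ]

theorem aux_step (A : (ℝ × ℝ) →L[ℝ] (ℝ × ℝ)) (k : ℕ)
    (hA : ∀ v : ℝ × ℝ, v ≠ 0 → (A ^ k) v ≠ v) :
    ∃ r > 0, ∀ F : ℝ × ℝ → ℝ × ℝ, Differentiable ℝ F → (∀ p : ℝ × ℝ, ‖fderiv ℝ F p - A‖ < r) →
      (∀ p : ℝ × ℝ, ∀ μ : ℝ, 1 ≤ μ → μ < 1 + r → ∀ v : ℝ × ℝ, v ≠ 0 →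
        fderiv ℝ (F^[k]) p v ≠ μ • v) ∧
      (∀ p q : ℝ × ℝ, F^[k] p = p → F^[k] q = q → p = q) := by
  have hinj : LinearMap.ker ((A ^ k - 1 : (ℝ × ℝ) →L[ℝ] (ℝ × ℝ)) : (ℝ × ℝ) →ₗ[ℝ] (ℝ × ℝ)) = ⊥ := by
    rw [LinearMap.ker_eq_bot']
    intro v hv
    by_contra hne
    exact hA v hne (sub_eq_zero.1 hv)
  obtain ⟨K, hK, hanti⟩ := LinearMap.exists_antilipschitzWith _ hinj
  have hK' : (0 : ℝ) < K := hK
  have hlow : ∀ v : ℝ × ℝ, ‖v‖ ≤ K * ‖(A ^ k) v - v‖ := by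
    intro v
    have := hanti.le_mul_dist v 0
    rw [dist_eq_norm, dist_eq_norm, map_zero, sub_zero, sub_zero] at this
    exact this
  set c : ℝ := 1 / (4 * K) with hc
  have hc0 : 0 < c := by positivity
  have hKc : K * c = 1 / 4 := by rw [hc]; field_simp
  obtain ⟨δ, hδ, H⟩ := aux_deriv A k c hc0
  refine ⟨min δ c, lt_min hδ hc0, fun F hF hFA => ?_⟩
  have hD := H F hF (fun p => (hFA p).trans_le (min_le_left _ _))
  constructor
  · intro p μ h1 h2 v hv heq
    have hv0 : 0 < ‖v‖ := norm_pos_iff.2 hv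
    have e : (A ^ k) v - v = (μ - 1) • v - (fderiv ℝ (F^[k]) p - A ^ k) v := by
      rw [sub_apply, heq, sub_smul, one_smul]; abel
    have b1 : ‖(fderiv ℝ (F^[k]) p - A ^ k) v‖ ≤ c * ‖v‖ :=
      ContinuousLinearMap.le_of_opNorm_le _ (hD p).le v
    have b2 : ‖(μ - 1) • v‖ ≤ c * ‖v‖ := by
      rw [norm_smul, Real.norm_of_nonneg (by linarith)]
      have := min_le_right δ c
      gcongr; linarith
    have b3 : ‖(A ^ k) v - v‖ ≤ c * ‖v‖ + c * ‖v‖ := by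
      rw [e]; exact (norm_sub_le _ _).trans (add_le_add b2 b1)
    have b4 := (hlow v).trans (mul_le_mul_of_nonneg_left b3 hK'.le)
    have : K * (c * ‖v‖ + c * ‖v‖) = (K * c) * ‖v‖ * 2 := by ring
    rw [this, hKc] at b4
    linarith
  · intro p q hp hq
    have hb : ‖F^[k] p - F^[k] q - (A ^ k) (p - q)‖ ≤ c * ‖p - q‖ :=
      convex_univ.norm_image_sub_le_of_norm_fderiv_le' (𝕜 := ℝ)
        (fun x _ => hF.iterate k x) (fun x _ => (hD x).le) (Set.mem_univ q) (Set.mem_univ p)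
    rw [hp, hq, norm_sub_rev] at hb
    have b4 := (hlow (p - q)).trans (mul_le_mul_of_nonneg_left hb hK'.le)
    rw [← mul_assoc, hKc] at b4
    have : ‖p - q‖ = 0 := by linarith [norm_nonneg (p - q)]
    exact sub_eq_zero.1 (norm_eq_zero.1 this)


/-- If `A` is an invertible linear map of the plane such that for each `k = 1, …, n` the
power `A^k` has no eigenvalue in `[1, 1+ε)`, then for `δ` small enough, every `C¹` map
`F` with `F(0) = 0` and `‖DF_p − A‖ < δ` for all `p` satisfies
`Spec(F^k) ∩ [1, 1+ε') = ∅` for some `ε' > 0` and all `1 ≤ k ≤ n`, and hence each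
iterate `F^k` has at most one fixed point. -/
theorem stmt19 (n : ℕ) (ε : ℝ) (hε : 0 < ε)
    (A : (ℝ × ℝ) →L[ℝ] (ℝ × ℝ)) (hAinv : Function.Bijective A)
    (hAspec : ∀ k : ℕ, 1 ≤ k → k ≤ n → ∀ μ : ℝ, 1 ≤ μ → μ < 1 + ε →
      ∀ v : ℝ × ℝ, v ≠ 0 → (A ^ k) v ≠ μ • v) :
    ∃ δ > 0, ∀ F : ℝ × ℝ → ℝ × ℝ, ContDiff ℝ 1 F → F 0 = 0 →
      (∀ p : ℝ × ℝ, ‖fderiv ℝ F p - A‖ < δ) →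
      (∃ ε' > 0, ∀ k : ℕ, 1 ≤ k → k ≤ n → ∀ p : ℝ × ℝ, ∀ μ : ℝ,
        1 ≤ μ → μ < 1 + ε' → ∀ v : ℝ × ℝ, v ≠ 0 → fderiv ℝ (F^[k]) p v ≠ μ • v) ∧
      (∀ k : ℕ, 1 ≤ k → k ≤ n → ∀ p q : ℝ × ℝ, F^[k] p = p → F^[k] q = q → p = q) := by
  have key : ∀ k : ℕ, ∃ r > 0, (1 ≤ k → k ≤ n → ∀ F : ℝ × ℝ → ℝ × ℝ, Differentiable ℝ F →
      (∀ p : ℝ × ℝ, ‖fderiv ℝ F p - A‖ < r) →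
      (∀ p : ℝ × ℝ, ∀ μ : ℝ, 1 ≤ μ → μ < 1 + r → ∀ v : ℝ × ℝ, v ≠ 0 →
        fderiv ℝ (F^[k]) p v ≠ μ • v) ∧
      (∀ p q : ℝ × ℝ, F^[k] p = p → F^[k] q = q → p = q)) := by
    intro k
    by_cases h : 1 ≤ k ∧ k ≤ n
    · obtain ⟨r, hr, H⟩ := aux_step A k (fun v hv => by
        simpa using hAspec k h.1 h.2 1 le_rfl (by linarith) v hv)
      exact ⟨r, hr, fun _ _ => H⟩
    · exact ⟨1, one_pos, fun h1 h2 => absurd ⟨h1, h2⟩ h⟩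
  choose r hr H using key
  have hmin : ∃ d > 0, ∀ k ≤ n, d ≤ r k := by
    obtain ⟨j, _, hj⟩ := Finset.exists_min_image (Finset.range (n + 1)) r ⟨0, by simp⟩
    exact ⟨r j, hr j, fun k hk => hj k (by simp; omega)⟩
  obtain ⟨d, hd, hdr⟩ := hmin
  refine ⟨d, hd, fun F hF _ hFA => ?_⟩
  have hF' : Differentiable ℝ F := hF.differentiable (by norm_num)
  refine ⟨⟨d, hd, fun k h1 h2 p μ m1 m2 => ?_⟩, fun k h1 h2 => ?_⟩
  · exact (H k h1 h2 F hF' fun p => (hFA p).trans_le (hdr k h2)).1 p μ m1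
      (by linarith [hdr k h2])
  · exact (H k h1 h2 F hF' fun p => (hFA p).trans_le (hdr k h2)).2
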